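/- Let G be a group and S a finite subset of G with k ≥ 3 elements such that 1 ∉ S and S⁻¹ = S. For n ∈ ℕ let B_n := ⋃_{m ≤ n} S^m be the set of products of at most n elements of S (with B_0 = {1}). Let ℓ, n be natural numbers with ℓ < n and let g ∈ B_ℓ. Then (k − 2) · |B_n| ≤ ((k − 1)^{ℓ+1} − 1) · |B_n ∩ g·B_n|; equivalently, |B_n ∩ g·B_n| / |B_n| ≥ (k − 2) / ((k − 1)^{ℓ+1} − 1). -/

import Mathlib

open scoped Pointwise

/-- `B_n := ⋃_{m ≤ n} S^m`, the ball of radius `n` for the generating set `S`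
(`B_0 = {1}`). -/
def ballOf {G : Type*} [Group G] [DecidableEq G] (S : Finset G) (n : ℕ) : Finset G :=
  (Finset.range (n + 1)).biUnion fun m => S ^ m

theorem mem_ballOf {G : Type*} [Group G] [DecidableEq G] {S : Finset G} {n : ℕ} {x : G} :
    x ∈ ballOf S n ↔ ∃ m ≤ n, x ∈ S ^ m := by
  simp [ballOf]

theorem ballOf_mono {G : Type*} [Group G] [DecidableEq G] (S : Finset G) :
    Monotone (ballOf S) := by
  intro m n h x hx
  obtain ⟨i, hi, hx⟩ := mem_ballOf.1 hx
  exact mem_ballOf.2 ⟨i, hi.trans h, hx⟩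

theorem mul_mem_ballOf {G : Type*} [Group G] [DecidableEq G] {S : Finset G} {m n : ℕ} {x y : G}
    (hx : x ∈ ballOf S m) (hy : y ∈ ballOf S n) : x * y ∈ ballOf S (m + n) := by
  obtain ⟨i, hi, hx⟩ := mem_ballOf.1 hx
  obtain ⟨j, hj, hy⟩ := mem_ballOf.1 hy
  exact mem_ballOf.2 ⟨i + j, add_le_add hi hj, pow_add S i j ▸ Finset.mul_mem_mul hx hy⟩

theorem inv_mem_ballOf {G : Type*} [Group G] [DecidableEq G] {S : Finset G} (hsymm : S⁻¹ = S)
    {n : ℕ} {x : G} (hx : x ∈ ballOf S n) : x⁻¹ ∈ ballOf S n := by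
  obtain ⟨i, hi, hx⟩ := mem_ballOf.1 hx
  refine mem_ballOf.2 ⟨i, hi, ?_⟩
  rw [← hsymm, inv_pow]
  exact Finset.inv_mem_inv hx

theorem mul_mem_ballOf_succ {G : Type*} [Group G] [DecidableEq G] {S : Finset G} {n : ℕ} {x s : G}
    (hx : x ∈ ballOf S n) (hs : s ∈ S) : x * s ∈ ballOf S (n + 1) :=
  mul_mem_ballOf hx (mem_ballOf.2 ⟨1, le_rfl, by simpa using hs⟩)

theorem exists_mul_eq_of_mem_sphere {G : Type*} [Group G] [DecidableEq G] {S : Finset G} {n : ℕ}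
    {x : G} (hx : x ∈ ballOf S (n + 1) \ ballOf S n) : ∃ y ∈ ballOf S n, ∃ s ∈ S, y * s = x := by
  obtain ⟨hx, hxn⟩ := Finset.mem_sdiff.1 hx
  obtain ⟨i, hi, hx⟩ := mem_ballOf.1 hx
  obtain rfl : i = n + 1 := by
    by_contra h
    exact hxn (mem_ballOf.2 ⟨i, by omega, hx⟩)
  rw [pow_succ] at hx
  obtain ⟨y, hy, s, hs, rfl⟩ := Finset.mem_mul.1 hx
  exact ⟨y, mem_ballOf.2 ⟨n, le_rfl, hy⟩, s, hs, rfl⟩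

/-- Past radius one, each sphere is at most `|S| - 1` times as large as the preceding one. -/
theorem card_sphere_succ_le {G : Type*} [Group G] [DecidableEq G] {S : Finset G}
    (hsymm : S⁻¹ = S) (n : ℕ) :
    (ballOf S (n + 2) \ ballOf S (n + 1)).card ≤
      (S.card - 1) * (ballOf S (n + 1) \ ballOf S n).card := by
  have hsub : ballOf S (n + 2) \ ballOf S (n + 1) ⊆
      (ballOf S (n + 1) \ ballOf S n).biUnion fun x => (x • S) \ ballOf S (n + 1) := by
    intro y hy
    obtain ⟨x, hx, s, hs, rfl⟩ := exists_mul_eq_of_mem_sphere hy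
    have hy' := (Finset.mem_sdiff.1 hy).2
    exact Finset.mem_biUnion.2 ⟨x, Finset.mem_sdiff.2 ⟨hx, fun h => hy' (mul_mem_ballOf_succ h hs)⟩,
      Finset.mem_sdiff.2 ⟨Finset.smul_mem_smul_finset hs, hy'⟩⟩
  refine (Finset.card_le_card hsub).trans ?_
  rw [mul_comm]
  refine Finset.card_biUnion_le_card_mul _ _ _ fun x hx => ?_
  obtain ⟨y, hy, s, hs, rfl⟩ := exists_mul_eq_of_mem_sphere hx
  have hs' : s⁻¹ ∈ S := hsymm ▸ Finset.inv_mem_inv hs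
  have hmem : y ∈ (y * s) • S := by
    simpa using Finset.smul_mem_smul_finset (a := y * s) hs'
  have hle : ((y * s) • S \ ballOf S (n + 1)).card ≤ (((y * s) • S).erase y).card := by
    refine Finset.card_le_card fun z hz => ?_
    obtain ⟨hz, hzn⟩ := Finset.mem_sdiff.1 hz
    refine Finset.mem_erase.2 ⟨?_, hz⟩
    rintro rfl
    exact hzn (ballOf_mono S n.le_succ hy)
  rwa [Finset.card_erase_of_mem hmem, Finset.card_smul_finset] at hle

theorem card_sphere_add_le {G : Type*} [Group G] [DecidableEq G] {S : Finset G}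
    (hsymm : S⁻¹ = S) (n j : ℕ) :
    (ballOf S (n + j + 1) \ ballOf S (n + j)).card ≤
      (S.card - 1) ^ j * (ballOf S (n + 1) \ ballOf S n).card := by
  induction j with
  | zero => simp
  | succ j ih =>
    calc _ ≤ (S.card - 1) * (ballOf S (n + j + 1) \ ballOf S (n + j)).card :=
          card_sphere_succ_le hsymm (n + j)
      _ ≤ (S.card - 1) * ((S.card - 1) ^ j * (ballOf S (n + 1) \ ballOf S n).card) := by gcongr
      _ = _ := by ring

theorem card_ballOf_add_le {G : Type*} [Group G] [DecidableEq G] {S : Finset G}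
    (hsymm : S⁻¹ = S) (n j : ℕ) :
    (ballOf S (n + 1 + j)).card ≤
      (∑ i ∈ Finset.range (j + 1), (S.card - 1) ^ i) * (ballOf S (n + 1)).card := by
  induction j with
  | zero => simp
  | succ j ih =>
    have hsphere := card_sphere_add_le hsymm n (j + 1)
    have hle : (ballOf S (n + 1) \ ballOf S n).card ≤ (ballOf S (n + 1)).card :=
      Finset.card_le_card Finset.sdiff_subset
    have hcard := Finset.card_sdiff_add_card_eq_card
      (ballOf_mono S (Nat.le_succ (n + (j + 1))))
    rw [Finset.sum_range_succ, add_mul]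
    have hmul := Nat.mul_le_mul_left ((S.card - 1) ^ (j + 1)) hle
    rw [show n + 1 + j = n + (j + 1) by ring] at ih
    rw [show n + 1 + (j + 1) = (n + (j + 1)).succ by omega]
    rw [← hcard]
    simp only [Nat.succ_eq_add_one]
    linarith

theorem ballOf_sub_subset_inter_smul {G : Type*} [Group G] [DecidableEq G] {S : Finset G}
    (hsymm : S⁻¹ = S) {ℓ n : ℕ} (h : ℓ ≤ n) {g : G} (hg : g ∈ ballOf S ℓ) :
    ballOf S (n - ℓ) ⊆ ballOf S n ∩ g • ballOf S n := by
  intro x hx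
  refine Finset.mem_inter.2 ⟨ballOf_mono S (Nat.sub_le n ℓ) hx, ?_⟩
  rw [← Finset.inv_smul_mem_iff, smul_eq_mul, ← Nat.add_sub_cancel' h]
  exact mul_mem_ballOf (inv_mem_ballOf hsymm hg) (by simpa using hx)

/-- if `S` is a finite symmetric set of `k ≥ 3` elements with `1 ∉ S`,
then for `ℓ < n` and `g ∈ B_ℓ`,
`(k−2)·|B_n| ≤ ((k−1)^{ℓ+1} − 1)·|B_n ∩ g·B_n|`; equivalently
`|B_n ∩ g·B_n| / |B_n| ≥ (k−2) / ((k−1)^{ℓ+1} − 1)`. -/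
theorem card_ball_inter_smul_ball_lower_bound {G : Type*} [Group G] [DecidableEq G]
    (S : Finset G) (k : ℕ) (hcard : S.card = k) (hk : 3 ≤ k)
    (hone : (1 : G) ∉ S) (hsymm : S⁻¹ = S) (ℓ n : ℕ) (hℓn : ℓ < n)
    (g : G) (hg : g ∈ ballOf S ℓ) :
    (k - 2) * (ballOf S n).card ≤
        ((k - 1) ^ (ℓ + 1) - 1) * (ballOf S n ∩ g • ballOf S n).card ∧
      ((ballOf S n ∩ g • ballOf S n).card : ℝ) / (ballOf S n).card ≥
        ((k : ℝ) - 2) / (((k : ℝ) - 1) ^ (ℓ + 1) - 1) := by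
  subst hcard
  have hmain : (ballOf S n).card ≤ (∑ i ∈ Finset.range (ℓ + 1), (S.card - 1) ^ i) *
      (ballOf S n ∩ g • ballOf S n).card := by
    obtain ⟨m, rfl⟩ : ∃ m, n = m + 1 + ℓ := ⟨n - ℓ - 1, by omega⟩
    refine (card_ballOf_add_le hsymm m ℓ).trans (Nat.mul_le_mul_left _ (Finset.card_le_card ?_))
    simpa using ballOf_sub_subset_inter_smul hsymm hℓn.le hg
  obtain ⟨d, hd⟩ : ∃ d, S.card = d + 2 := ⟨S.card - 2, by omega⟩
  have hd_pos : 0 < d := by omega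
  have hgeom : d * ∑ i ∈ Finset.range (ℓ + 1), (d + 1) ^ i + 1 = (d + 1) ^ (ℓ + 1) := by
    have h := geom_sum_mul_add d (ℓ + 1)
    rwa [mul_comm] at h
  rw [hd, show d + 2 - 1 = d + 1 by omega] at hmain
  rw [hd, show d + 2 - 2 = d by omega, show d + 2 - 1 = d + 1 by omega]
  have hnat : d * (ballOf S n).card ≤
      ((d + 1) ^ (ℓ + 1) - 1) * (ballOf S n ∩ g • ballOf S n).card := by
    rw [← hgeom, Nat.add_sub_cancel, mul_assoc]
    exact Nat.mul_le_mul_left d hmain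
  refine ⟨hnat, ?_⟩
  have hball : 0 < (ballOf S n).card :=
    Finset.card_pos.2 ⟨1, mem_ballOf.2 ⟨0, Nat.zero_le n, by simp⟩⟩
  have hpow : 1 < (d + 1) ^ (ℓ + 1) := Nat.one_lt_pow (by omega) (by omega)
  have hcast : (((d + 2 : ℕ) : ℝ) - 1) ^ (ℓ + 1) - 1 = (((d + 1) ^ (ℓ + 1) - 1 : ℕ) : ℝ) := by
    rw [Nat.cast_sub hpow.le]
    push_cast
    ring
  rw [hcast, show ((d + 2 : ℕ) : ℝ) - 2 = d by push_cast; ring, ge_iff_le,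
    div_le_div_iff₀ (by exact_mod_cast Nat.sub_pos_of_lt hpow) (by exact_mod_cast hball),
    mul_comm ((ballOf S n ∩ g • ballOf S n).card : ℝ)]
  exact_mod_cast hnat
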